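/- arXiv:1802.07994 — 2 statements merged into one kernel-verified Lean document; each statement's English description precedes it below -/
import Mathlib

section
/- (Upper bound on λ in terms of the boundary; graph case of Theorem 2.) Let D ⊆ ℝ² be a nonempty bounded open set whose boundary ∂D is a C¹ curve, and suppose there exists a function u : ℝ² → ℝ, continuously differentiable on a neighborhood of the closure of D, satisfying the λ-soliton graph equation on D. Then λ < ℋ¹(∂D) / (2·area(D)); in particular, not every real value of λ admits such a solution on D. -/
open MeasureTheory

noncomputable section

/-- The Euclidean plane. -/
abbrev E2 := EuclideanSpace ℝ (Fin 2)

/-- `W u x = √(1 + ‖∇u(x)‖²)`. -/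
noncomputable def W (u : E2 → ℝ) (x : E2) : ℝ := Real.sqrt (1 + ‖gradient u x‖ ^ 2)

/-- The divergence of a vector field `X : ℝ² → ℝ²`: `div X = ∂₁X₁ + ∂₂X₂`. -/
noncomputable def div2 (X : E2 → E2) (x : E2) : ℝ :=
  ∑ i : Fin 2, fderiv ℝ X x (EuclideanSpace.single i 1) i

/-- `u` satisfies the λ-soliton graph equation on the open set `D`: `u` is C² on `D` and
`div (∇u / W(u)) = 2λ + 1/W(u)` at every point of `D`. -/
def SatisfiesSolitonEq (lam : ℝ) (D : Set E2) (u : E2 → ℝ) : Prop :=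
  ContDiffOn ℝ 2 u D ∧
    ∀ x ∈ D, div2 (fun y => (W u y)⁻¹ • gradient u y) x = 2 * lam + (W u x)⁻¹

end

/-- `s` is a closed regular C¹ curve in the plane: the image of a periodic, regular,
C¹ parametrization which is injective on a fundamental period. -/
def IsC1ClosedCurve (s : Set E2) : Prop :=
  ∃ γ : ℝ → E2, ContDiff ℝ 1 γ ∧ Function.Periodic γ 1 ∧
    Set.InjOn γ (Set.Ico (0 : ℝ) 1) ∧ (∀ t : ℝ, deriv γ t ≠ 0) ∧ Set.range γ = s

open Metric Set Filter Topology
open scoped NNReal ENNReal ContDiff Manifold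

theorem integral_mul_div2_le {D : Set E2} (hD : IsOpen D) {X : E2 → E2}
    (hX : ContDiffOn ℝ 1 X D) (hX1 : ∀ x, ‖X x‖ ≤ 1) {φ : E2 → ℝ} {K : ℝ≥0}
    (hφ : LipschitzWith K φ) (hc : HasCompactSupport φ) (hs : tsupport φ ⊆ D)
    {A : Set E2} (hA : MeasurableSet A) (hAfin : volume A ≠ ⊤)
    (hφA : ∀ x ∉ A, fderiv ℝ φ x = 0) :
    ∫ x, φ x * div2 X x ≤ K * (volume A).toReal := by
  obtain ⟨L, hL, hφL, hLD⟩ := exists_compact_between hc hD hs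
  obtain ⟨χ, hχ1, hχ0, hχ⟩ := exists_contMDiffMap_one_nhds_of_subset_interior 𝓘(ℝ, E2)
    (n := 1) (isClosed_tsupport φ) hφL
  have hχd : ContDiff ℝ 1 χ := χ.contMDiff.contDiff
  have hχsupp : tsupport χ ⊆ L :=
    closure_minimal (fun x hx => by_contra fun h => hx (hχ0 x h)) hL.isClosed
  set Y : E2 → E2 := fun x => χ x • X x with hY
  have hYd : ContDiff ℝ 1 Y := by
    refine contDiff_iff_contDiffAt.2 fun x => ?_
    by_cases hx : x ∈ D
    · exact hχd.contDiffAt.smul (hX.contDiffAt (hD.mem_nhds hx))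
    · have : Y =ᶠ[𝓝 x] fun _ => 0 := by
        have h0 : χ =ᶠ[𝓝 x] 0 := notMem_tsupport_iff_eventuallyEq.1 fun h => hx (hLD (hχsupp h))
        filter_upwards [h0] with y hy
        simp [hY, hy]
      exact contDiffAt_const.congr_of_eventuallyEq this
  have hYc : HasCompactSupport Y :=
    HasCompactSupport.intro hL fun x hx => by simp [hY, hχ0 x hx]
  have hY1 : ∀ x, ‖Y x‖ ≤ 1 := fun x => by
    rw [hY, norm_smul, Real.norm_of_nonneg (hχ x).1]
    exact mul_le_one₀ (hχ x).2 (norm_nonneg _) (hX1 x)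
  have hYid : ∀ i : Fin 2, ContDiff ℝ 1 fun x => Y x i := fun i => by fun_prop
  have hYic : ∀ i : Fin 2, HasCompactSupport fun x => Y x i := fun i =>
    hYc.comp_left (g := fun v : E2 => v i) rfl
  have hline : ∀ (i : Fin 2) (v x : E2),
      lineDeriv ℝ (fun x => Y x i) x v = fderiv ℝ Y x v i := fun i v x => by
    have h1 : DifferentiableAt ℝ (fun x => Y x i) x := (hYid i).differentiable one_ne_zero x
    rw [h1.lineDeriv_eq_fderiv]
    have h2 := (EuclideanSpace.proj (𝕜 := ℝ) i).hasFDerivAt.comp x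
      (hYd.differentiable one_ne_zero x).hasFDerivAt
    exact congrArg (fun T => T v) h2.fderiv
  have hdiv : ∀ x, φ x * div2 X x = ∑ i : Fin 2,
      lineDeriv ℝ (fun x => Y x i) x (EuclideanSpace.single i 1) * φ x := fun x => by
    by_cases hx : x ∈ tsupport φ
    · have hYX : Y =ᶠ[𝓝 x] X := by
        filter_upwards [(eventually_nhdsSet_iff_forall.1 hχ1) x hx] with y hy
        simp [hY, hy]
      simp only [hline, div2, hYX.fderiv_eq, Finset.mul_sum]
      exact Finset.sum_congr rfl fun i _ => mul_comm _ _
    · simp [image_eq_zero_of_notMem_tsupport hx]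
  have hint1 : ∀ i : Fin 2, Integrable fun x =>
      lineDeriv ℝ (fun x => Y x i) x (EuclideanSpace.single i 1) * φ x := fun i => by
    simp only [hline]
    refine Continuous.integrable_of_hasCompactSupport ?_ hc.mul_left
    have := hYd.continuous_fderiv one_ne_zero
    have := hφ.continuous
    fun_prop
  have hint2 : ∀ i : Fin 2, Integrable fun x =>
      lineDeriv ℝ φ x (-EuclideanSpace.single i 1) * Y x i := fun i =>
    (hφ.locallyIntegrable_lineDeriv (μ := volume) _).integrable_smul_right_of_hasCompactSupport
      (hYid i).continuous (hYic i)
  have hparts : ∀ i : Fin 2,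
      ∫ x, lineDeriv ℝ (fun x => Y x i) x (EuclideanSpace.single i 1) * φ x =
        ∫ x, lineDeriv ℝ φ x (-EuclideanSpace.single i 1) * Y x i := fun i => by
    obtain ⟨C, hC⟩ := ContDiff.lipschitzWith_of_hasCompactSupport (hYic i) (hYid i) one_ne_zero
    exact hC.integral_lineDeriv_mul_eq hφ hc _
  calc ∫ x, φ x * div2 X x
      = ∫ x, ∑ i : Fin 2, lineDeriv ℝ φ x (-EuclideanSpace.single i 1) * Y x i := by
        simp only [hdiv]
        rw [integral_finsetSum _ fun i _ => hint1 i, integral_finsetSum _ fun i _ => hint2 i]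
        exact Finset.sum_congr rfl fun i _ => hparts i
    _ ≤ ∫ x, A.indicator (fun _ => (K : ℝ)) x := by
        refine integral_mono_ae (integrable_finsetSum _ fun i _ => hint2 i)
          ((integrable_indicator_iff hA).2 (integrableOn_const hAfin)) ?_
        filter_upwards [hφ.ae_differentiableAt] with x hx
        have hsum : ∑ i : Fin 2, lineDeriv ℝ φ x (-EuclideanSpace.single i 1) * Y x i =
            -fderiv ℝ φ x (Y x) := by
          have hYx : Y x = ∑ i : Fin 2, Y x i • EuclideanSpace.single i (1 : ℝ) := by
            ext j; fin_cases j <;> simp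
          conv_rhs => rw [hYx]
          simp only [hx.lineDeriv_eq_fderiv, map_sum, map_smul, map_neg, smul_eq_mul,
            ← Finset.sum_neg_distrib]
          exact Finset.sum_congr rfl fun i _ => by ring
        rw [hsum]
        by_cases hxA : x ∈ A
        · rw [indicator_of_mem hxA]
          refine (neg_le_abs _).trans (((fderiv ℝ φ x).le_opNorm (Y x)).trans ?_)
          exact (mul_le_mul (norm_fderiv_le_of_lipschitz ℝ hφ) (hY1 x) (norm_nonneg _)
            K.2).trans_eq (mul_one _)
        · simp [hφA x hxA, indicator_of_notMem hxA]
    _ = K * (volume A).toReal := by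
        rw [integral_indicator_const _ hA, smul_eq_mul, mul_comm]
        rfl

theorem norm_le_abs_add_abs (v : E2) : ‖v‖ ≤ |v 0| + |v 1| := by
  rw [EuclideanSpace.norm_eq, Fin.sum_univ_two, Real.norm_eq_abs, Real.norm_eq_abs]
  exact Real.sqrt_le_iff.2 ⟨by positivity, by nlinarith [abs_nonneg (v 0), abs_nonneg (v 1)]⟩

theorem abs_apply_sub_le (L : E2 ≃ₗᵢ[ℝ] E2) (x y : E2) (i : Fin 2) :
    |L x i - L y i| ≤ dist x y := by
  rw [← L.dist_map, dist_eq_norm, ← Real.norm_eq_abs]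
  exact PiLp.norm_apply_le (L x - L y) i

theorem exists_linearIsometryEquiv_apply {v : E2} (hv : v ≠ 0) :
    ∃ L : E2 ≃ₗᵢ[ℝ] E2, 0 < L v 0 ∧ L v 1 = 0 := by
  have hn : 0 < ‖v‖ := norm_pos_iff.2 hv
  have ho : Orthonormal ℝ (({0} : Set (Fin 2)).domRestrict fun _ => ‖v‖⁻¹ • v) := by
    refine ⟨fun i => ?_, fun i j hij => (hij (Subsingleton.elim _ _)).elim⟩
    simp [norm_smul, hn.ne']
  obtain ⟨b, hb⟩ := ho.exists_orthonormalBasis_extension_of_card_eq (by simp)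
  have hv' : v = ‖v‖ • b 0 := by rw [hb 0 rfl, smul_inv_smul₀ hn.ne']
  refine ⟨b.repr, ?_, ?_⟩
  · rw [hv']; simpa using hv
  · rw [hv']; simp

/-- The set of points whose first coordinate is `r`-close to that of `p` and which lie at vertical
distance less than `r` from the graph of `G`, in the coordinates given by `L`. -/
def graphBox (L : E2 ≃ₗᵢ[ℝ] E2) (G : ℝ → ℝ) (p : E2) (r : ℝ) : Set E2 :=
  {x | |L x 0 - L p 0| < r ∧ |L x 1 - G (L x 0)| < r}

/-- Near `p`, the set `Γ` is the graph of the `κ`-Lipschitz function `G` in the coordinates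
given by `L`. -/
structure IsLocalGraph (Γ : Set E2) (κ : ℝ≥0) (L : E2 ≃ₗᵢ[ℝ] E2) (G : ℝ → ℝ) (p : E2) (r : ℝ) :
    Prop where
  lipschitz : LipschitzWith κ G
  pos : 0 < r
  apply_one : L p 1 = G (L p 0)
  mem_iff : ∀ x ∈ graphBox L G p r, x ∈ Γ ↔ L x 1 = G (L x 0)

theorem IsLocalGraph.self_mem_graphBox {Γ : Set E2} {κ : ℝ≥0} {L : E2 ≃ₗᵢ[ℝ] E2} {G : ℝ → ℝ}
    {p : E2} {r : ℝ} (h : IsLocalGraph Γ κ L G p r) : p ∈ graphBox L G p r :=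
  ⟨by simpa using h.pos, by simpa [h.apply_one] using h.pos⟩

theorem isOpen_graphBox (L : E2 ≃ₗᵢ[ℝ] E2) {G : ℝ → ℝ} (hG : Continuous G) (p : E2) (r : ℝ) :
    IsOpen (graphBox L G p r) := by
  have := L.continuous
  have h0 : Continuous fun x => |L x 0 - L p 0| := by fun_prop
  have h1 : Continuous fun x => |L x 1 - G (L x 0)| := by fun_prop
  exact (isOpen_lt h0 continuous_const).inter (isOpen_lt h1 continuous_const)

theorem exists_int_sub_eq_of_periodic_of_injOn {γ : ℝ → E2} (hper : Function.Periodic γ 1)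
    (hinj : InjOn γ (Ico 0 1)) {s t : ℝ} (h : γ s = γ t) : ∃ z : ℤ, s - t = z := by
  have hf : ∀ x, γ (Int.fract x) = γ x := fun x => by
    rw [← Int.self_sub_floor]
    simpa using hper.sub_int_mul_eq (x := x) ⌊x⌋
  have := hinj ⟨Int.fract_nonneg s, Int.fract_lt_one s⟩ ⟨Int.fract_nonneg t, Int.fract_lt_one t⟩
    (by rw [hf, hf, h])
  exact Int.fract_eq_fract.1 this

theorem exists_isLocalGraph {γ : ℝ → E2} (hγ : ContDiff ℝ 1 γ) (hper : Function.Periodic γ 1)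
    (hinj : InjOn γ (Ico 0 1)) (hreg : ∀ t, deriv γ t ≠ 0) (t₀ : ℝ) {κ : ℝ≥0} (hκ : 0 < κ) :
    ∃ L G r, IsLocalGraph (range γ) κ L G (γ t₀) r := by
  obtain ⟨L, hL0, hL1⟩ := exists_linearIsometryEquiv_apply (hreg t₀)
  have hder : ∀ (i : Fin 2) t, HasDerivAt (fun t => L (γ t) i) (L (deriv γ t) i) t := fun i t => by
    have h1 := (hγ.differentiable one_ne_zero t).hasDerivAt
    exact (((EuclideanSpace.proj (𝕜 := ℝ) i).comp
      (L.toContinuousLinearEquiv : E2 →L[ℝ] E2)).hasFDerivAt.comp_hasDerivAt t h1)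
  have hcont : ∀ i : Fin 2, Continuous fun t => L (deriv γ t) i := fun i => by
    have := hγ.continuous_deriv le_rfl
    have := L.continuous
    fun_prop
  have hnear : ∀ᶠ t in 𝓝 t₀, |L (deriv γ t) 1| < κ * L (deriv γ t) 0 := by
    refine ContinuousAt.eventually_lt (hcont 1).abs.continuousAt
      ((hcont 0).const_mul _ |>.continuousAt) ?_
    rw [hL1, abs_zero]
    exact mul_pos hκ hL0
  obtain ⟨τ₀, hτ₀, hball⟩ := Metric.eventually_nhds_iff.1 hnear
  set τ := min (τ₀ / 2) (1 / 4) with hτdef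
  have hτ : 0 < τ := by positivity
  have hτ1 : τ ≤ τ₀ / 2 := min_le_left _ _
  have hτ2 : τ ≤ 1 / 4 := min_le_right _ _
  set I := Icc (t₀ - τ) (t₀ + τ) with hI
  have hIκ : ∀ t ∈ I, |L (deriv γ t) 1| < κ * L (deriv γ t) 0 := fun t ht => by
    refine hball ?_
    rw [Real.dist_eq, abs_lt]
    constructor <;> linarith [ht.1, ht.2]
  have hIpos : ∀ t ∈ I, 0 < L (deriv γ t) 0 := fun t ht =>
    pos_of_mul_pos_right ((abs_nonneg _).trans_lt (hIκ t ht)) κ.2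
  have hconv : Convex ℝ I := convex_Icc _ _
  have hfc : Continuous fun t => L (γ t) 0 := by
    have := hγ.continuous; have := L.continuous; fun_prop
  have hmono : StrictMonoOn (fun t => L (γ t) 0) I :=
    strictMonoOn_of_deriv_pos hconv hfc.continuousOn
      fun t ht => by rw [(hder 0 t).deriv]; exact hIpos t (interior_subset ht)
  have hslope : ∀ σ : ℝ, |σ| = 1 → MonotoneOn (fun t => κ * L (γ t) 0 - σ * L (γ t) 1) I := by
    intro σ hσ
    have hd : ∀ t, HasDerivAt (fun t => κ * L (γ t) 0 - σ * L (γ t) 1)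
        (κ * L (deriv γ t) 0 - σ * L (deriv γ t) 1) t := fun t =>
      ((hder 0 t).const_mul _).sub ((hder 1 t).const_mul _)
    refine monotoneOn_of_deriv_nonneg hconv (fun t _ => (hd t).continuousAt.continuousWithinAt)
      (fun t _ => (hd t).differentiableAt.differentiableWithinAt) fun t ht => ?_
    rw [(hd t).deriv]
    have h1 := hIκ t (interior_subset ht)
    have h2 : σ * L (deriv γ t) 1 ≤ |L (deriv γ t) 1| := by
      refine (le_abs_self _).trans ?_
      rw [abs_mul, hσ, one_mul]
    linarith
  have hlip' : ∀ s ∈ I, ∀ t ∈ I, s ≤ t →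
      |L (γ s) 1 - L (γ t) 1| ≤ κ * |L (γ s) 0 - L (γ t) 0| := fun s hs t ht hst => by
    have h1 := hslope 1 (by simp) hs ht hst
    have h2 := hslope (-1) (by simp) hs ht hst
    have h3 := hmono.monotoneOn hs ht hst
    simp only at h1 h2 h3
    rw [abs_of_nonpos (sub_nonpos.2 h3), abs_le]
    constructor <;> linarith
  have hlip : ∀ s ∈ I, ∀ t ∈ I,
      |L (γ s) 1 - L (γ t) 1| ≤ κ * |L (γ s) 0 - L (γ t) 0| := fun s hs t ht => by
    rcases le_total s t with h | h
    · exact hlip' s hs t ht h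
    · rw [abs_sub_comm, abs_sub_comm (L (γ s) 0)]; exact hlip' t ht s hs h
  have hG : ∃ G : ℝ → ℝ, LipschitzWith κ G ∧ ∀ t ∈ I, G (L (γ t) 0) = L (γ t) 1 := by
    set F := Function.invFunOn (fun t => L (γ t) 0) I
    have hF : ∀ t ∈ I, F (L (γ t) 0) = t := fun t ht => hmono.injOn.leftInvOn_invFunOn ht
    have : LipschitzOnWith κ (fun y => L (γ (F y)) 1) ((fun t => L (γ t) 0) '' I) := by
      refine LipschitzOnWith.of_dist_le_mul ?_
      rintro _ ⟨s, hs, rfl⟩ _ ⟨t, ht, rfl⟩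
      simp only [hF s hs, hF t ht, Real.dist_eq]
      exact hlip s hs t ht
    obtain ⟨G, hG, hGe⟩ := this.extend_real
    exact ⟨G, hG, fun t ht => by rw [← hGe (mem_image_of_mem _ ht)]; simp only [hF t ht]⟩
  obtain ⟨G, hGlip, hG⟩ := hG
  have ht₀ : t₀ ∈ I := ⟨by linarith, by linarith⟩
  have hK : IsCompact (γ '' Icc (t₀ + τ) (t₀ + 1 - τ)) := isCompact_Icc.image hγ.continuous
  have hpK : γ t₀ ∉ γ '' Icc (t₀ + τ) (t₀ + 1 - τ) := by
    rintro ⟨s, hs, hst⟩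
    obtain ⟨z, hz⟩ := exists_int_sub_eq_of_periodic_of_injOn hper hinj hst
    have h1 : (0 : ℝ) < z := by linarith [hs.1]
    have h2 : (z : ℝ) < 1 := by linarith [hs.2]
    have h3 : 0 < z := by exact_mod_cast h1
    have h4 : z < 1 := by exact_mod_cast h2
    omega
  obtain ⟨ρ, hρ, hρK⟩ := Metric.isOpen_iff.1 hK.isClosed.isOpen_compl _ hpK
  have hlt1 := hmono (left_mem_Icc.2 (by linarith)) ht₀ (show t₀ - τ < t₀ by linarith)
  have hlt2 := hmono ht₀ (right_mem_Icc.2 (by linarith)) (show t₀ < t₀ + τ by linarith)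
  simp only at hlt1 hlt2
  have hκ0 : (0 : ℝ) ≤ κ := κ.2
  set r := min (min (L (γ t₀) 0 - L (γ (t₀ - τ)) 0) (L (γ (t₀ + τ)) 0 - L (γ t₀) 0))
    (ρ / (2 + κ)) with hr
  have hr1 : r ≤ L (γ t₀) 0 - L (γ (t₀ - τ)) 0 := (min_le_left _ _).trans (min_le_left _ _)
  have hr2 : r ≤ L (γ (t₀ + τ)) 0 - L (γ t₀) 0 := (min_le_left _ _).trans (min_le_right _ _)
  have hr3 : r * (2 + κ) ≤ ρ := (le_div_iff₀ (by positivity)).1 (min_le_right _ _)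
  have hr0 : 0 < r := lt_min (lt_min (by linarith) (by linarith)) (by positivity)
  refine ⟨L, G, r, hGlip, hr0, (hG t₀ ht₀).symm, fun x hx => ⟨?_, fun h => ?_⟩⟩
  · rintro ⟨s, rfl⟩
    have hmem : γ s ∈ ball (γ t₀) ρ := by
      rw [mem_ball, ← L.dist_map, dist_eq_norm]
      refine (norm_le_abs_add_abs _).trans_lt ?_
      have h1 := hGlip.dist_le_mul (L (γ s) 0) (L (γ t₀) 0)
      rw [hG t₀ ht₀, Real.dist_eq, Real.dist_eq] at h1
      have h2 := abs_sub_le (L (γ s) 1) (G (L (γ s) 0)) (L (γ t₀) 1)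
      have h3 : κ * |L (γ s) 0 - L (γ t₀) 0| ≤ κ * r := by gcongr; exact hx.1.le
      have h4 := hx.1
      have h5 := hx.2
      simp only [PiLp.sub_apply]
      nlinarith
    obtain ⟨n, hn, -⟩ := existsUnique_add_zsmul_mem_Ico one_pos s (t₀ - τ)
    have hn' : γ (s + n • (1 : ℝ)) = γ s := (hper.zsmul n) s
    rw [← hn'] at hmem ⊢
    refine (hG _ ?_).symm
    by_contra hcon
    refine hρK hmem (mem_image_of_mem γ ⟨?_, by linarith [hn.2]⟩)
    by_contra! hlt
    exact hcon ⟨hn.1, hlt.le⟩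
  · have hx1 := abs_lt.1 hx.1
    obtain ⟨s, hs, hs'⟩ := intermediate_value_Icc (show t₀ - τ ≤ t₀ + τ by linarith)
      hfc.continuousOn (show L x 0 ∈ Icc _ _ from ⟨by linarith, by linarith⟩)
    refine ⟨s, L.injective ?_⟩
    simp only at hs'
    ext i
    fin_cases i
    · exact hs'
    · change L (γ s) 1 = L x 1
      rw [h, ← hs', hG s hs]

theorem isPreconnected_graphBox_side (L : E2 ≃ₗᵢ[ℝ] E2) {G : ℝ → ℝ} (hG : Continuous G) (p : E2)
    (r : ℝ) {σ : ℝ} (hσ : σ = 1 ∨ σ = -1) :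
    IsPreconnected {x ∈ graphBox L G p r | 0 < σ * (L x 1 - G (L x 0))} := by
  have hσ2 : σ * σ = 1 := by rcases hσ with rfl | rfl <;> norm_num
  have hσa : |σ| = 1 := by rcases hσ with rfl | rfl <;> norm_num
  have hΨ : Continuous fun z : ℝ × ℝ => L.symm !₂[z.1, G z.1 + σ * z.2] := by
    have := L.symm.continuous
    fun_prop
  have hpre : IsPreconnected (ball (L p 0) r ×ˢ Ioo 0 r) :=
    (convex_ball _ _).isPreconnected.prod isPreconnected_Ioo
  convert hpre.image _ hΨ.continuousOn using 1
  ext x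
  simp only [graphBox, mem_ofPred_eq, mem_image, mem_prod, mem_ball, Real.dist_eq, mem_Ioo,
    Prod.exists]
  constructor
  · rintro ⟨⟨h0, h1⟩, h2⟩
    refine ⟨L x 0, σ * (L x 1 - G (L x 0)), ⟨h0, h2, ?_⟩, ?_⟩
    · refine (le_abs_self _).trans_lt ?_
      rwa [abs_mul, hσa, one_mul]
    · rw [LinearIsometryEquiv.symm_apply_eq, ← mul_assoc, hσ2]
      ext i; fin_cases i <;> simp
  · rintro ⟨a, s, ⟨h0, h1, h2⟩, rfl⟩
    simp only [LinearIsometryEquiv.apply_symm_apply]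
    simp only [Matrix.cons_val_zero, Matrix.cons_val_one, add_sub_cancel_left,
      abs_mul, hσa, one_mul, ← mul_assoc, hσ2]
    exact ⟨⟨h0, by rwa [abs_of_pos h1]⟩, h1⟩

/-- If `p` is not interior to the closure of `D`, then one of the two sides of the local graph
does not meet `D`. -/
theorem IsLocalGraph.exists_side {D : Set E2} (hD : IsOpen D) {κ : ℝ≥0} {L : E2 ≃ₗᵢ[ℝ] E2}
    {G : ℝ → ℝ} {p : E2} {r : ℝ} (h : IsLocalGraph (frontier D) κ L G p r)
    (hp : p ∉ interior (closure D)) :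
    ∃ σ : ℝ, (σ = 1 ∨ σ = -1) ∧
      ∀ x ∈ graphBox L G p r, 0 < σ * (L x 1 - G (L x 0)) → x ∉ D := by
  by_contra! hcon
  refine hp (mem_interior.2 ⟨_, fun x hx => ?_, isOpen_graphBox L h.lipschitz.continuous p r,
    h.self_mem_graphBox⟩)
  have key : ∀ σ : ℝ, (σ = 1 ∨ σ = -1) → 0 < σ * (L x 1 - G (L x 0)) → x ∈ D := by
    intro σ hσ hx0
    obtain ⟨y, hy, hy0, hyD⟩ := hcon σ hσ
    have hsub : {x ∈ graphBox L G p r | 0 < σ * (L x 1 - G (L x 0))} ⊆ D ∪ (closure D)ᶜ := by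
      intro z hz
      by_contra hzn
      rw [mem_union, not_or, mem_compl_iff, not_not] at hzn
      have hzf : z ∈ frontier D := by
        rw [hD.frontier_eq]; exact ⟨hzn.2, hzn.1⟩
      have := (h.mem_iff z hz.1).1 hzf
      have h2 := hz.2
      rw [this, sub_self, mul_zero] at h2
      exact lt_irrefl _ h2
    exact (isPreconnected_graphBox_side L h.lipschitz.continuous p r hσ).subset_left_of_subset_union
      hD isClosed_closure.isOpen_compl
      (disjoint_compl_right.mono_left subset_closure |>.mono_right subset_rfl)
      hsub ⟨y, ⟨hy, hy0⟩, hyD⟩ ⟨hx, hx0⟩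
  rcases lt_trichotomy (L x 1 - G (L x 0)) 0 with hlt | heq | hgt
  · exact subset_closure (key (-1) (Or.inr rfl) (by linarith))
  · exact frontier_subset_closure ((h.mem_iff x hx).2 (sub_eq_zero.1 heq))
  · exact subset_closure (key 1 (Or.inl rfl) (by linarith))

/-- If `D` lies on one side of its boundary near `p`, then boundary points near `p` are not
interior to the closure of `D`. -/
theorem IsLocalGraph.notMem_interior_closure {D : Set E2} (hD : IsOpen D) {κ : ℝ≥0}
    {L : E2 ≃ₗᵢ[ℝ] E2} {G : ℝ → ℝ} {p : E2} {r : ℝ} (h : IsLocalGraph (frontier D) κ L G p r)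
    {σ : ℝ} (hσ : σ = 1 ∨ σ = -1)
    (hside : ∀ x ∈ graphBox L G p r, 0 < σ * (L x 1 - G (L x 0)) → x ∉ D)
    {q : E2} (hq : q ∈ graphBox L G p r) (hqD : q ∈ frontier D) :
    q ∉ interior (closure D) := by
  intro hqi
  have hσ2 : σ * σ = 1 := by rcases hσ with rfl | rfl <;> norm_num
  set y : ℝ → E2 := fun s => q + (s * σ) • L.symm (EuclideanSpace.single 1 1) with hy
  have hyc : Continuous y := by fun_prop
  have hy0 : y 0 = q := by simp [hy]
  have hU : IsOpen (graphBox L G p r ∩ interior (closure D)) :=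
    (isOpen_graphBox L h.lipschitz.continuous p r).inter isOpen_interior
  have hev : ∀ᶠ s in 𝓝[>] (0 : ℝ), y s ∈ graphBox L G p r ∩ interior (closure D) :=
    nhdsWithin_le_nhds (hyc.continuousAt.eventually_mem
      (by rw [hy0]; exact hU.mem_nhds ⟨hq, hqi⟩))
  obtain ⟨s, hs, hs0⟩ := (hev.and self_mem_nhdsWithin).exists
  have hq1 := (h.mem_iff q hq).1 hqD
  have e0 : L (y s) 0 = L q 0 := by simp [hy]
  have e1 : L (y s) 1 = L q 1 + s * σ := by simp [hy]
  have hdiff : L (y s) 1 - G (L (y s) 0) = s * σ := by rw [e0, e1, hq1]; ring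
  have hpos : 0 < σ * (L (y s) 1 - G (L (y s) 0)) := by
    rw [hdiff, mul_comm, mul_assoc, hσ2, mul_one]; exact hs0
  have hyD := hside _ hs.1 hpos
  have hyf : y s ∈ frontier D := by
    rw [hD.frontier_eq]; exact ⟨interior_subset hs.2, hyD⟩
  have := (h.mem_iff _ hs.1).1 hyf
  rw [this, sub_self, mul_zero] at hpos
  exact lt_irrefl _ hpos

theorem notMem_interior_closure_of_mem_frontier {D : Set E2} (hne : D.Nonempty) (hD : IsOpen D)
    (hbdd : Bornology.IsBounded D) {γ : ℝ → E2} (hγ : Continuous γ) (hrange : range γ = frontier D)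
    {κ : ℝ≥0} (hloc : ∀ t, ∃ L G r, IsLocalGraph (frontier D) κ L G (γ t) r) (t : ℝ) :
    γ t ∉ interior (closure D) := by
  have hopen : IsOpen {t | γ t ∈ interior (closure D)} := isOpen_interior.preimage hγ
  have hclosed : IsClosed {t | γ t ∈ interior (closure D)} := by
    refine isOpen_compl_iff.1 (isOpen_iff_mem_nhds.2 fun s hs => ?_)
    obtain ⟨L, G, r, h⟩ := hloc s
    obtain ⟨σ, hσ, hside⟩ := h.exists_side hD hs
    have hbox := (isOpen_graphBox L h.lipschitz.continuous (γ s) r).mem_nhds h.self_mem_graphBox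
    filter_upwards [hγ.continuousAt.eventually_mem hbox] with t ht
    exact h.notMem_interior_closure hD hσ hside ht (hrange ▸ mem_range_self t)
  rcases isClopen_iff.1 ⟨hclosed, hopen⟩ with he | he
  · exact fun ht => (he ▸ ht : t ∈ (∅ : Set ℝ))
  · exfalso
    have hsub : closure D ⊆ interior (closure D) := by
      rw [closure_eq_self_union_frontier]
      refine union_subset (interior_maximal subset_union_left hD) ?_
      rw [← closure_eq_self_union_frontier, ← hrange]
      rintro _ ⟨s, rfl⟩
      exact (he ▸ mem_univ s : s ∈ {t | γ t ∈ interior (closure D)})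
    have hclopen : IsClopen (closure D) :=
      ⟨isClosed_closure, subset_interior_iff_isOpen.1 hsub⟩
    rcases isClopen_iff.1 hclopen with h0 | h1
    · exact hne.closure.ne_empty h0
    · exact NormedSpace.unbounded_univ ℝ E2 (h1 ▸ hbdd.closure)

theorem volume_band_le (L : E2 ≃ₗᵢ[ℝ] E2) {G : ℝ → ℝ} (hG : Continuous G) (A B p q : ℝ) :
    volume {x | L x 0 ∈ Icc A B ∧ L x 1 - G (L x 0) ∈ Icc p q} ≤
      ENNReal.ofReal (B - A) * ENNReal.ofReal (q - p) := by
  have hmp : MeasurePreserving (fun x : E2 => (L x 0, L x 1)) volume volume :=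
    (volume_preserving_finTwoArrow ℝ).comp
      ((PiLp.volume_preserving_ofLp (Fin 2)).comp L.measurePreserving)
  have hT : MeasurableSet {z : ℝ × ℝ | z.1 ∈ Icc A B ∧ z.2 - G z.1 ∈ Icc p q} := by
    refine (IsClosed.inter ?_ ?_).measurableSet
    · exact isClosed_Icc.preimage continuous_fst
    · exact isClosed_Icc.preimage (by fun_prop : Continuous fun z : ℝ × ℝ => z.2 - G z.1)
  have hpre := hmp.measure_preimage hT.nullMeasurableSet
  refine (le_of_eq hpre).trans ?_
  rw [Measure.volume_eq_prod, Measure.prod_apply hT]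
  calc ∫⁻ a, volume (Prod.mk a ⁻¹' {z : ℝ × ℝ | z.1 ∈ Icc A B ∧ z.2 - G z.1 ∈ Icc p q})
      ≤ ∫⁻ a, (Icc A B).indicator (fun _ => ENNReal.ofReal (q - p)) a := by
        refine lintegral_mono fun a => ?_
        by_cases ha : a ∈ Icc A B
        · rw [indicator_of_mem ha]
          calc _ ≤ volume (Icc (p + G a) (q + G a)) := by
                refine measure_mono fun y hy => ?_
                have := hy.2
                exact ⟨by linarith [this.1], by linarith [this.2]⟩
            _ = ENNReal.ofReal (q - p) := by rw [Real.volume_Icc, add_sub_add_right_eq_sub]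
        · rw [indicator_of_notMem ha]
          refine le_of_eq (measure_mono_null (fun y hy => ha hy.1) measure_empty)
    _ = ENNReal.ofReal (B - A) * ENNReal.ofReal (q - p) := by
        rw [lintegral_indicator_const measurableSet_Icc, Real.volume_Icc, mul_comm]

/-- The part of `D` within distance `ε` of `S` has area at most `(1 + κ) ε (ℋ¹(S) + C ε)` for all
small `ε`. -/
def CollarBound (D : Set E2) (κ : ℝ≥0) (S : Set E2) : Prop :=
  ∃ C : ℝ, 0 ≤ C ∧ ∃ ε₀ > 0, ∀ ε, 0 < ε → ε < ε₀ →
    volume (D ∩ thickening ε S) ≤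
      ENNReal.ofReal ((1 + κ) * ε) * (μH[1] S + ENNReal.ofReal (C * ε))

theorem CollarBound.empty (D : Set E2) (κ : ℝ≥0) : CollarBound D κ ∅ :=
  ⟨0, le_rfl, 1, one_pos, fun ε _ _ => by simp⟩

theorem CollarBound.union {D : Set E2} {κ : ℝ≥0} {S T : Set E2} (hS : CollarBound D κ S)
    (hT : CollarBound D κ T) (hd : Disjoint S T) (hTm : MeasurableSet T) :
    CollarBound D κ (S ∪ T) := by
  obtain ⟨C, hC, ε₀, hε₀, h⟩ := hS
  obtain ⟨C', hC', ε₀', hε₀', h'⟩ := hT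
  refine ⟨C + C', add_nonneg hC hC', min ε₀ ε₀', lt_min hε₀ hε₀', fun ε hε hlt => ?_⟩
  have h1 := h ε hε (hlt.trans_le (min_le_left _ _))
  have h2 := h' ε hε (hlt.trans_le (min_le_right _ _))
  rw [thickening_union, inter_union_distrib_left, measure_union hd hTm, add_mul C,
    ENNReal.ofReal_add (by positivity) (by positivity), add_add_add_comm, mul_add]
  exact (measure_union_le _ _).trans (add_le_add h1 h2)

theorem ofReal_sSup_sub_sInf_le_hausdorffMeasure (L : E2 ≃ₗᵢ[ℝ] E2) {S : Set E2}
    (hS : IsConnected S) (hb : BddBelow ((fun x => L x 0) '' S))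
    (ha : BddAbove ((fun x => L x 0) '' S)) :
    ENNReal.ofReal (sSup ((fun x => L x 0) '' S) - sInf ((fun x => L x 0) '' S)) ≤ μH[1] S := by
  have hc : Continuous fun x => L x 0 := by
    have := L.continuous; fun_prop
  have hlip : LipschitzWith 1 fun x => L x 0 :=
    LipschitzWith.mk_one fun x y => abs_apply_sub_le L x y 0
  rw [← Real.volume_Ioo]
  refine (measure_mono ((hS.image _ hc.continuousOn).Ioo_csInf_csSup_subset hb ha)).trans ?_
  rw [← hausdorffMeasure_real]
  simpa using hlip.hausdorffMeasure_image_le zero_le_one S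

theorem IsLocalGraph.collarBound {D : Set E2} {κ : ℝ≥0} {L : E2 ≃ₗᵢ[ℝ] E2} {G : ℝ → ℝ} {p : E2}
    {r : ℝ} (h : IsLocalGraph (frontier D) κ L G p r) {σ : ℝ} (hσ : σ = 1 ∨ σ = -1)
    (hside : ∀ x ∈ graphBox L G p r, 0 < σ * (L x 1 - G (L x 0)) → x ∉ D) {S : Set E2}
    (hS : IsConnected S) (hSD : S ⊆ frontier D) (hSp : S ⊆ graphBox L G p (r / 2)) :
    CollarBound D κ S := by
  have hr := h.pos
  have hκ : (0 : ℝ) ≤ κ := κ.2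
  have hb : BddBelow ((fun x => L x 0) '' S) := ⟨L p 0 - r / 2, by
    rintro _ ⟨x, hx, rfl⟩
    have := (abs_lt.1 (hSp hx).1).1
    simp only; linarith⟩
  have ha : BddAbove ((fun x => L x 0) '' S) := ⟨L p 0 + r / 2, by
    rintro _ ⟨x, hx, rfl⟩
    have := (abs_lt.1 (hSp hx).1).2
    simp only; linarith⟩
  have hH := ofReal_sSup_sub_sInf_le_hausdorffMeasure L hS hb ha
  have hAB := csInf_le_csSup (hS.nonempty.image _) hb ha
  set A := sInf ((fun x => L x 0) '' S) with hA
  set B := sSup ((fun x => L x 0) '' S) with hB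
  refine ⟨2, zero_le_two, min (r / 2) (r / (1 + κ)), by positivity, fun ε hε hlt => ?_⟩
  have hε1 : ε < r / 2 := hlt.trans_le (min_le_left _ _)
  have hε2 : (1 + κ) * ε < r := by
    rw [mul_comm]
    exact (lt_div_iff₀ (by positivity)).1 (hlt.trans_le (min_le_right _ _))
  have key : ∀ x ∈ D ∩ thickening ε S, L x 0 ∈ Icc (A - ε) (B + ε) ∧
      |L x 1 - G (L x 0)| ≤ (1 + κ) * ε ∧ σ * (L x 1 - G (L x 0)) ≤ 0 := by
    rintro x ⟨hxD, hxS⟩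
    obtain ⟨y, hyS, hxy⟩ := mem_thickening_iff.1 hxS
    have h0 := (abs_apply_sub_le L x y 0).trans hxy.le
    have h1 := (abs_apply_sub_le L x y 1).trans hxy.le
    have hyA : A ≤ L y 0 := csInf_le hb (mem_image_of_mem _ hyS)
    have hyB : L y 0 ≤ B := le_csSup ha (mem_image_of_mem _ hyS)
    have hybox : y ∈ graphBox L G p r :=
      ⟨(hSp hyS).1.trans (by linarith), (hSp hyS).2.trans (by linarith)⟩
    have hy := (h.mem_iff y hybox).1 (hSD hyS)
    have hGl := h.lipschitz.dist_le_mul (L x 0) (L y 0)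
    rw [Real.dist_eq, Real.dist_eq, ← hy] at hGl
    have hGl' : |G (L x 0) - L y 1| ≤ κ * ε := hGl.trans (by gcongr)
    have hd : |L x 1 - G (L x 0)| ≤ (1 + κ) * ε := by
      rw [abs_le] at *
      constructor <;> linarith
    refine ⟨?_, hd, ?_⟩
    · rw [abs_le] at h0
      exact ⟨by linarith, by linarith⟩
    · by_contra! hpos
      refine hside x ⟨?_, hd.trans_lt hε2⟩ hpos hxD
      have h2 := (hSp hyS).1
      have h3 := abs_sub_le (L x 0) (L y 0) (L p 0)
      linarith
  have hvol : volume (D ∩ thickening ε S) ≤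
      ENNReal.ofReal (B + ε - (A - ε)) * ENNReal.ofReal ((1 + κ) * ε) := by
    rcases hσ with rfl | rfl
    · refine (measure_mono fun x hx => ?_).trans ((volume_band_le L h.lipschitz.continuous
        (A - ε) (B + ε) (-((1 + κ) * ε)) 0).trans_eq (by rw [zero_sub, neg_neg]))
      obtain ⟨h1, h2, h3⟩ := key x hx
      exact ⟨h1, (abs_le.1 h2).1, by linarith⟩
    · refine (measure_mono fun x hx => ?_).trans ((volume_band_le L h.lipschitz.continuous
        (A - ε) (B + ε) 0 ((1 + κ) * ε)).trans_eq (by rw [sub_zero]))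
      obtain ⟨h1, h2, h3⟩ := key x hx
      exact ⟨h1, by linarith, (abs_le.1 h2).2⟩
  refine hvol.trans ?_
  rw [mul_comm, show B + ε - (A - ε) = (B - A) + 2 * ε by ring,
    ENNReal.ofReal_add (by linarith) (by positivity)]
  gcongr

theorem collarBound_frontier {D : Set E2} (hne : D.Nonempty) (hD : IsOpen D)
    (hbdd : Bornology.IsBounded D) {γ : ℝ → E2} (hγ : ContDiff ℝ 1 γ)
    (hper : Function.Periodic γ 1) (hinj : InjOn γ (Ico 0 1)) (hreg : ∀ t, deriv γ t ≠ 0)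
    (hrange : range γ = frontier D) {κ : ℝ≥0} (hκ : 0 < κ) : CollarBound D κ (frontier D) := by
  have hloc : ∀ t, ∃ L G r, IsLocalGraph (frontier D) κ L G (γ t) r := fun t =>
    hrange ▸ exists_isLocalGraph hγ hper hinj hreg t hκ
  have hV : ∀ t, ∃ V : Set E2, IsOpen V ∧ γ t ∈ V ∧
      ∀ S, IsConnected S → S ⊆ frontier D → S ⊆ V → CollarBound D κ S := fun t => by
    obtain ⟨L, G, r, h⟩ := hloc t
    obtain ⟨σ, hσ, hside⟩ := h.exists_side hD
      (notMem_interior_closure_of_mem_frontier hne hD hbdd hγ.continuous hrange hloc t)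
    refine ⟨_, isOpen_graphBox L h.lipschitz.continuous (γ t) (r / 2), ?_,
      fun S hS hSD hSV => h.collarBound hσ hside hS hSD hSV⟩
    have := half_pos h.pos
    exact ⟨by simpa using this, by simpa [h.apply_one] using this⟩
  choose V hVo hVt hVS using hV
  obtain ⟨δ, hδ, hleb⟩ := lebesgue_number_lemma_of_metric (isCompact_Icc (a := (0 : ℝ)) (b := 1))
    (c := fun t => γ ⁻¹' V t) (fun t => (hVo t).preimage hγ.continuous)
    (fun t _ => mem_iUnion.2 ⟨t, hVt t⟩)
  obtain ⟨n, hn⟩ := exists_nat_one_div_lt hδ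
  have hn0 : (0 : ℝ) < n + 1 := by positivity
  have hstep : ∀ k : ℕ, k ≤ n + 1 → CollarBound D κ (γ '' Ico 0 (k / (n + 1 : ℝ))) := by
    intro k
    induction k with
    | zero => intro _; simpa using CollarBound.empty D κ
    | succ k ih =>
      intro hk
      have hk1 : ((k + 1 : ℕ) : ℝ) ≤ n + 1 := by exact_mod_cast hk
      have ha0 : (0 : ℝ) ≤ k / (n + 1) := by positivity
      have hab : ((k + 1 : ℕ) : ℝ) / (n + 1) = k / (n + 1) + 1 / (n + 1) := by
        push_cast; ring
      have hinv : (0 : ℝ) < 1 / (n + 1) := by positivity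
      have hb1 : ((k + 1 : ℕ) : ℝ) / (n + 1) ≤ 1 := (div_le_one hn0).2 hk1
      have hle : (k : ℝ) / (n + 1) ≤ ((k + 1 : ℕ) : ℝ) / (n + 1) := by linarith
      rw [← Ico_union_Ico_eq_Ico ha0 hle, image_union]
      have hsub : Ico ((k : ℝ) / (n + 1)) (((k + 1 : ℕ) : ℝ) / (n + 1)) ⊆ Ico 0 1 :=
        Ico_subset_Ico ha0 hb1
      refine (ih (by omega)).union ?_ ?_ ?_
      · obtain ⟨t, ht⟩ := hleb (k / (n + 1)) ⟨ha0, hle.trans hb1⟩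
        refine hVS t _ ?_ ?_ ?_
        · exact (isConnected_Ico (by linarith)).image _ hγ.continuous.continuousOn
        · rw [← hrange]; exact image_subset_range _ _
        · rw [image_subset_iff]
          refine Subset.trans (fun s hs => ?_) ht
          rw [mem_ball, Real.dist_eq, abs_of_nonneg (by linarith [hs.1])]
          linarith [hs.2]
      · exact disjoint_image_image fun x hx y hy hxy => by
          have := hinj (Ico_subset_Ico_right (hle.trans hb1) hx) (hsub hy) hxy
          linarith [hx.2, hy.1]
      · exact measurableSet_Ico.image_of_continuousOn_injOn hγ.continuous.continuousOn
          (hinj.mono hsub)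
  have hfull := hstep (n + 1) le_rfl
  rw [Nat.cast_succ, div_self hn0.ne'] at hfull
  have : γ '' Ico 0 1 = frontier D := by
    rw [← hrange]
    refine (image_subset_range _ _).antisymm ?_
    rintro _ ⟨t, rfl⟩
    obtain ⟨s, hs, hst⟩ := hper.exists_mem_Ico₀ one_pos t
    exact ⟨s, hs, hst.symm⟩
  rwa [this] at hfull

theorem hausdorffMeasure_range_lt_top {γ : ℝ → E2} (hγ : ContDiff ℝ 1 γ)
    (hper : Function.Periodic γ 1) : μH[1] (range γ) < ⊤ := by
  obtain ⟨C, hC⟩ := (hγ.contDiffOn (s := Icc 0 1)).exists_lipschitzOnWith one_ne_zero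
    (convex_Icc 0 1) isCompact_Icc
  rw [← hper.image_Icc one_pos 0, zero_add]
  refine (hC.hausdorffMeasure_image_le zero_le_one).trans_lt ?_
  rw [hausdorffMeasure_real, Real.volume_Icc]
  exact ENNReal.mul_lt_top (by simp) ENNReal.ofReal_lt_top

/-- The cutoff which vanishes within distance `a` of the complement of `D`, equals `1` at distance
at least `a + ε`, and interpolates linearly in the distance in between. -/
noncomputable def cutoff (D : Set E2) (a ε : ℝ) (x : E2) : ℝ :=
  max 0 (min 1 ((infDist x Dᶜ - a) / ε))

theorem cutoff_nonneg (D : Set E2) (a ε : ℝ) (x : E2) : 0 ≤ cutoff D a ε x := le_max_left _ _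

theorem cutoff_le_one (D : Set E2) (a ε : ℝ) (x : E2) : cutoff D a ε x ≤ 1 :=
  max_le zero_le_one (min_le_left _ _)

theorem cutoff_eq_zero {D : Set E2} {a ε : ℝ} (hε : 0 < ε) {x : E2} (hx : infDist x Dᶜ ≤ a) :
    cutoff D a ε x = 0 :=
  max_eq_left ((min_le_right _ _).trans
    (div_nonpos_of_nonpos_of_nonneg (sub_nonpos.2 hx) hε.le))

theorem cutoff_eq_one {D : Set E2} {a ε : ℝ} (hε : 0 < ε) {x : E2} (hx : a + ε ≤ infDist x Dᶜ) :
    cutoff D a ε x = 1 := by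
  rw [cutoff, min_eq_left ((one_le_div hε).2 (by linarith)), max_eq_right zero_le_one]

theorem lipschitzWith_cutoff (D : Set E2) (a : ℝ) {ε : ℝ} (hε : 0 < ε) :
    LipschitzWith (Real.toNNReal ε⁻¹) (cutoff D a ε) := by
  refine LipschitzWith.const_max (LipschitzWith.const_min ?_ 1) 0
  refine LipschitzWith.of_dist_le_mul fun x y => ?_
  have := (lipschitz_infDist_pt Dᶜ).dist_le_mul x y
  rw [NNReal.coe_one, one_mul, Real.dist_eq] at this
  rw [Real.coe_toNNReal _ (inv_pos.2 hε).le, Real.dist_eq, ← sub_div, sub_sub_sub_cancel_right,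
    abs_div, abs_of_pos hε, div_eq_inv_mul]
  gcongr

theorem tsupport_cutoff_subset {D : Set E2} {a ε : ℝ} (ha : 0 < a) (hε : 0 < ε) :
    tsupport (cutoff D a ε) ⊆ D := by
  have h1 : tsupport (cutoff D a ε) ⊆ {x | a ≤ infDist x Dᶜ} :=
    closure_minimal (fun x hx => le_of_not_ge fun h => hx (cutoff_eq_zero hε h))
      (isClosed_le continuous_const (continuous_infDist_pt _))
  refine h1.trans fun x hx => by_contra fun hxD => ?_
  have hx' : a ≤ infDist x Dᶜ := hx
  rw [infDist_zero_of_mem (show x ∈ Dᶜ from hxD)] at hx'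
  linarith

theorem fderiv_cutoff_eq_zero {D : Set E2} {a ε : ℝ} (hε : 0 < ε) {x : E2}
    (hx : x ∉ {x | a ≤ infDist x Dᶜ ∧ infDist x Dᶜ ≤ a + ε}) :
    fderiv ℝ (cutoff D a ε) x = 0 := by
  have hc : Continuous fun x => infDist x Dᶜ := continuous_infDist_pt _
  rcases lt_or_ge (infDist x Dᶜ) a with h | h
  · have : cutoff D a ε =ᶠ[𝓝 x] fun _ => 0 := by
      filter_upwards [hc.continuousAt.eventually_lt continuousAt_const h] with y hy
      exact cutoff_eq_zero hε hy.le
    rw [this.fderiv_eq, fderiv_fun_const, Pi.zero_apply]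
  · have h' : a + ε < infDist x Dᶜ := lt_of_not_ge fun h' => hx ⟨h, h'⟩
    have : cutoff D a ε =ᶠ[𝓝 x] fun _ => 1 := by
      filter_upwards [continuousAt_const.eventually_lt hc.continuousAt h'] with y hy
      exact cutoff_eq_one hε hy.le
    rw [this.fderiv_eq, fderiv_fun_const, Pi.zero_apply]

theorem ne_univ_of_isBounded {D : Set E2} (hbdd : Bornology.IsBounded D) : D ≠ univ :=
  fun h => NormedSpace.unbounded_univ ℝ E2 (h ▸ hbdd)

theorem integral_cutoff_mul_div2_le {D : Set E2} (hD : IsOpen D) (hbdd : Bornology.IsBounded D)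
    {X : E2 → E2} (hX : ContDiffOn ℝ 1 X D) (hX1 : ∀ x, ‖X x‖ ≤ 1) {κ : ℝ≥0} (hκ : 0 < κ)
    (hcol : CollarBound D κ (frontier D)) (hfin : μH[1] (frontier D) ≠ ⊤) :
    ∃ C : ℝ, ∃ ε₀ > 0, ∀ ε, 0 < ε → ε < ε₀ → ∫ x, cutoff D (κ * ε) ε x * div2 X x ≤
      (1 + κ) * (1 + 2 * κ) * ((μH[1] (frontier D)).toReal + C * ε) := by
  obtain ⟨C, hC, ε₀, hε₀, h⟩ := hcol
  have hκ' : (0 : ℝ) < κ := hκ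
  refine ⟨C * (1 + 2 * κ), ε₀ / (1 + 2 * κ), by positivity, fun ε hε hlt => ?_⟩
  rw [lt_div_iff₀ (by positivity)] at hlt
  set A : Set E2 := {x | κ * ε ≤ infDist x Dᶜ ∧ infDist x Dᶜ ≤ κ * ε + ε} with hA
  have hAsub : A ⊆ D ∩ thickening (ε * (1 + 2 * κ)) (frontier D) := fun x hx => by
    have hxD : x ∈ D := by_contra fun hxD => by
      have := hx.1
      rw [infDist_zero_of_mem (show x ∈ Dᶜ from hxD)] at this
      linarith [mul_pos hκ' hε]
    obtain ⟨y, hy, hxy⟩ := exists_mem_frontier_infDist_compl_eq_dist hxD (ne_univ_of_isBounded hbdd)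
    refine ⟨hxD, mem_thickening_iff.2 ⟨y, hy, ?_⟩⟩
    rw [← hxy]
    linarith [hx.2, mul_pos hκ' hε]
  have hAm : MeasurableSet A := by
    have hc : Continuous fun x => infDist x Dᶜ := continuous_infDist_pt _
    exact ((isClosed_le continuous_const hc).inter (isClosed_le hc continuous_const)).measurableSet
  have hAfin : volume A ≠ ⊤ :=
    ((measure_mono (hAsub.trans inter_subset_left)).trans_lt hbdd.measure_lt_top).ne
  have hsupp := tsupport_cutoff_subset (D := D) (mul_pos hκ' hε) hε
  have hcs : HasCompactSupport (cutoff D (κ * ε) ε) :=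
    hbdd.isCompact_closure.of_isClosed_subset (isClosed_tsupport _) (hsupp.trans subset_closure)
  have hmain := integral_mul_div2_le hD hX hX1 (lipschitzWith_cutoff D (κ * ε) hε) hcs hsupp hAm
    hAfin fun x hx => fderiv_cutoff_eq_zero hε hx
  have hvol := (measure_mono hAsub).trans (h (ε * (1 + 2 * κ)) (by positivity) hlt)
  have hvol' : (volume A).toReal ≤ (1 + κ) * (ε * (1 + 2 * κ)) *
      ((μH[1] (frontier D)).toReal + C * (ε * (1 + 2 * κ))) := by
    have := ENNReal.toReal_mono (ENNReal.mul_ne_top ENNReal.ofReal_ne_top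
      (ENNReal.add_ne_top.2 ⟨hfin, ENNReal.ofReal_ne_top⟩)) hvol
    rwa [ENNReal.toReal_mul, ENNReal.toReal_add hfin ENNReal.ofReal_ne_top,
      ENNReal.toReal_ofReal (by positivity), ENNReal.toReal_ofReal (by positivity)] at this
  rw [Real.coe_toNNReal _ (inv_pos.2 hε).le] at hmain
  refine hmain.trans ((mul_le_mul_of_nonneg_left hvol' (inv_pos.2 hε).le).trans_eq ?_)
  field_simp

theorem tendsto_integral_cutoff_mul {D : Set E2} (hD : IsOpen D) (hbdd : Bornology.IsBounded D)
    {f : E2 → ℝ} (hf : ContinuousOn f D) {M : ℝ} (hM : ∀ x ∈ D, |f x| ≤ M) {κ : ℝ} (hκ : 0 < κ) :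
    Tendsto (fun ε => ∫ x, cutoff D (κ * ε) ε x * f x) (𝓝[>] 0) (𝓝 (∫ x in D, f x)) := by
  have hpos : ∀ᶠ ε : ℝ in 𝓝[>] 0, 0 < ε := self_mem_nhdsWithin
  have hlim : Tendsto (fun ε => ∫ x in D, cutoff D (κ * ε) ε x * f x) (𝓝[>] 0)
      (𝓝 (∫ x in D, f x)) := by
    refine tendsto_integral_filter_of_dominated_convergence (fun _ => M) ?_ ?_
      (integrableOn_const hbdd.measure_lt_top.ne) ?_
    · filter_upwards [hpos] with ε hε
      exact ((lipschitzWith_cutoff D _ hε).continuous.continuousOn.mul hf).aestronglyMeasurable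
        hD.measurableSet
    · filter_upwards with ε
      refine (ae_restrict_iff' hD.measurableSet).2 (ae_of_all _ fun x hx => ?_)
      rw [norm_mul, Real.norm_of_nonneg (cutoff_nonneg _ _ _ _)]
      exact (mul_le_of_le_one_left (norm_nonneg _) (cutoff_le_one _ _ _ _)).trans (hM x hx)
    · refine (ae_restrict_iff' hD.measurableSet).2 (ae_of_all _ fun x hx => ?_)
      have hd : 0 < infDist x Dᶜ := (hD.isClosed_compl.notMem_iff_infDist_pos
        (nonempty_compl.2 (ne_univ_of_isBounded hbdd))).1 (not_not.2 hx)
      have hsmall : ∀ᶠ ε : ℝ in 𝓝[>] 0, κ * ε + ε < infDist x Dᶜ := by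
        refine nhdsWithin_le_nhds (ContinuousAt.eventually_lt (f := fun ε : ℝ => κ * ε + ε)
          (by fun_prop) continuousAt_const ?_)
        simpa using hd
      refine tendsto_const_nhds.congr' ?_
      filter_upwards [hpos, hsmall] with ε hε hlt
      rw [cutoff_eq_one hε hlt.le, one_mul]
  refine hlim.congr' ?_
  filter_upwards [hpos] with ε hε
  refine setIntegral_eq_integral_of_forall_compl_eq_zero fun x hx => ?_
  rw [cutoff_eq_zero hε, zero_mul]
  rw [infDist_zero_of_mem (show x ∈ Dᶜ from hx)]
  positivity

theorem setIntegral_div2_le_hausdorffMeasure_frontier {D : Set E2} (hD : IsOpen D)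
    (hbdd : Bornology.IsBounded D) (hcol : ∀ κ : ℝ≥0, 0 < κ → CollarBound D κ (frontier D))
    (hfin : μH[1] (frontier D) ≠ ⊤) {X : E2 → E2} (hX : ContDiffOn ℝ 1 X D)
    (hX1 : ∀ x, ‖X x‖ ≤ 1) (hdiv : ContinuousOn (div2 X) D) {M : ℝ}
    (hM : ∀ x ∈ D, |div2 X x| ≤ M) :
    ∫ x in D, div2 X x ≤ (μH[1] (frontier D)).toReal := by
  have hκ : ∀ κ : ℝ, 0 < κ →
      ∫ x in D, div2 X x ≤ (1 + κ) * (1 + 2 * κ) * (μH[1] (frontier D)).toReal := by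
    intro κ hκ
    lift κ to ℝ≥0 using hκ.le
    obtain ⟨C, ε₀, hε₀, h⟩ := integral_cutoff_mul_div2_le hD hbdd hX hX1 hκ (hcol κ hκ) hfin
    have hR : Tendsto (fun ε : ℝ => (1 + κ) * (1 + 2 * κ) *
        ((μH[1] (frontier D)).toReal + C * ε)) (𝓝[>] 0)
        (𝓝 ((1 + κ) * (1 + 2 * κ) * (μH[1] (frontier D)).toReal)) := by
      refine tendsto_nhdsWithin_of_tendsto_nhds (Continuous.tendsto' (by fun_prop) _ _ ?_)
      simp
    refine le_of_tendsto_of_tendsto (tendsto_integral_cutoff_mul hD hbdd hdiv hM hκ) hR ?_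
    filter_upwards [Ioo_mem_nhdsGT hε₀] with ε hε
    exact h ε hε.1 hε.2
  have hR : Tendsto (fun κ : ℝ => (1 + κ) * (1 + 2 * κ) * (μH[1] (frontier D)).toReal) (𝓝[>] 0)
      (𝓝 (μH[1] (frontier D)).toReal) := by
    refine tendsto_nhdsWithin_of_tendsto_nhds (Continuous.tendsto' (by fun_prop) _ _ ?_)
    simp
  refine ge_of_tendsto hR ?_
  filter_upwards [self_mem_nhdsWithin] with κ hpos
  exact hκ κ hpos

theorem one_le_W (u : E2 → ℝ) (x : E2) : 1 ≤ W u x :=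
  Real.one_le_sqrt.2 (by linarith [sq_nonneg ‖gradient u x‖])

theorem norm_inv_W_smul_gradient_le_one (u : E2 → ℝ) (x : E2) :
    ‖(W u x)⁻¹ • gradient u x‖ ≤ 1 := by
  have hW : 0 < W u x := one_pos.trans_le (one_le_W u x)
  rw [norm_smul, norm_inv, Real.norm_of_nonneg hW.le, inv_mul_le_one₀ hW]
  exact Real.le_sqrt_of_sq_le (by linarith)

theorem contDiffOn_gradient {D : Set E2} (hD : IsOpen D) {u : E2 → ℝ} (hu : ContDiffOn ℝ 2 u D) :
    ContDiffOn ℝ 1 (gradient u) D :=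
  (InnerProductSpace.toDual ℝ E2).symm.contDiff.comp_contDiffOn
    (hu.fderiv_of_isOpen hD (by norm_num))

theorem contDiffOn_W {D : Set E2} (hD : IsOpen D) {u : E2 → ℝ} (hu : ContDiffOn ℝ 2 u D) :
    ContDiffOn ℝ 1 (W u) D :=
  (contDiffOn_const.add ((contDiffOn_gradient hD hu).norm_sq ℝ)).sqrt fun x _ => by positivity

/-- Upper bound on λ in terms of the boundary; graph case of Theorem 2. -/
theorem lambda_upper_bound
    (D : Set E2) (hD : D.Nonempty) (hDopen : IsOpen D) (hDbdd : Bornology.IsBounded D)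
    (hbdry : IsC1ClosedCurve (frontier D))
    (lam : ℝ) (u : E2 → ℝ)
    (hreg : ∃ U : Set E2, IsOpen U ∧ closure D ⊆ U ∧ ContDiffOn ℝ 1 u U)
    (hsol : SatisfiesSolitonEq lam D u) :
    lam < (μH[1] (frontier D)).toReal / (2 * (volume D).toReal) := by
  obtain ⟨γ, hγ, hper, hinj, hγreg, hrange⟩ := hbdry
  obtain ⟨hu, heq⟩ := hsol
  have hfin : μH[1] (frontier D) ≠ ⊤ := hrange ▸ (hausdorffMeasure_range_lt_top hγ hper).ne
  have hW0 : ∀ x, W u x ≠ 0 := fun x => (one_pos.trans_le (one_le_W u x)).ne'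
  have hWinv : ∀ x, 0 < (W u x)⁻¹ := fun x => inv_pos.2 (one_pos.trans_le (one_le_W u x))
  have hWinv1 : ∀ x, (W u x)⁻¹ ≤ 1 := fun x => inv_le_one_of_one_le₀ (one_le_W u x)
  have hWd : ContDiffOn ℝ 1 (fun x => (W u x)⁻¹) D :=
    (contDiffOn_W hDopen hu).inv fun x _ => hW0 x
  have hbound := setIntegral_div2_le_hausdorffMeasure_frontier
    (X := fun y => (W u y)⁻¹ • gradient u y) hDopen hDbdd
    (fun κ hκ => collarBound_frontier hD hDopen hDbdd hγ hper hinj hγreg hrange hκ) hfin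
    (hWd.smul (contDiffOn_gradient hDopen hu)) (norm_inv_W_smul_gradient_le_one u)
    ((continuousOn_const.add hWd.continuousOn).congr heq) (M := |2 * lam| + 1) fun x hx => by
      rw [heq x hx]
      exact (abs_add_le _ _).trans (by gcongr; rw [abs_of_pos (hWinv x)]; exact hWinv1 x)
  have hvfin : volume D ≠ ⊤ := hDbdd.measure_lt_top.ne
  have hconst (c : ℝ) : Integrable (fun _ : E2 => c) (volume.restrict D) :=
    integrableOn_const hvfin
  have hint : IntegrableOn (fun x => (W u x)⁻¹) D :=
    (hconst 1).mono' (hWd.continuousOn.aestronglyMeasurable hDopen.measurableSet)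
      (ae_of_all _ fun x => by rw [Real.norm_of_nonneg (hWinv x).le]; exact hWinv1 x)
  have hvpos : 0 < (volume D).toReal :=
    ENNReal.toReal_pos (hDopen.measure_pos volume hD).ne' hvfin
  have hintpos : 0 < ∫ x in D, (W u x)⁻¹ := by
    rw [setIntegral_pos_iff_support_of_nonneg_ae (ae_of_all _ fun x => (hWinv x).le) hint,
      Function.support_eq_univ fun x => (hWinv x).ne', univ_inter]
    exact hDopen.measure_pos volume hD
  have hsplit : ∫ x in D, div2 (fun y => (W u y)⁻¹ • gradient u y) x =
      (volume D).toReal * (2 * lam) + ∫ x in D, (W u x)⁻¹ := by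
    rw [setIntegral_congr_fun hDopen.measurableSet heq,
      integral_add (hconst _) hint, setIntegral_const, smul_eq_mul]
    rfl
  rw [lt_div_iff₀ (by positivity)]
  linarith
end

section
/- (One-sidedness with respect to the boundary plane; graph form of the corollary that a λ-translating graph with boundary in a plane Π orthogonal to the density vector lies on one side of Π.) Let D ⊆ ℝ² be a nonempty bounded connected open set and let u be continuous on the closure of D, equal to 0 at every point of the boundary ∂D, and satisfy the λ-soliton graph equation on D. Then exactly one of the following holds: (i) if λ = −1/2 then u ≡ 0 on the closure of D; (ii) if λ > −1/2 then u(x) < 0 for every x ∈ D; (iii) if λ < −1/2 then u(x) > 0 for every x ∈ D. -/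
open MeasureTheory

/-- Second-order necessary condition at a local maximum on the real line. -/
theorem IsLocalMax.second_deriv_nonpos {f f' : ℝ → ℝ} {a f'' : ℝ} (hmax : IsLocalMax f a)
    (hf : ∀ᶠ t in nhds a, HasDerivAt f (f' t) t) (hf' : HasDerivAt f' f'' a) : f'' ≤ 0 := by
  by_contra! hpos
  have hderiv : deriv f =ᶠ[nhds a] f' := hf.mono fun t ht => ht.deriv
  have hsecond : deriv (deriv f) a = f'' := by rw [hderiv.deriv_eq, hf'.deriv]
  have hmin : IsLocalMin f a :=
    isLocalMin_of_deriv_deriv_pos (by rwa [hsecond]) hmax.deriv_eq_zero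
      hf.self_of_nhds.continuousAt
  have hconst : f =ᶠ[nhds a] fun _ => f a := by
    filter_upwards [hmax, hmin] with t h₁ h₂ using le_antisymm h₁ h₂
  have hzero : deriv (deriv f) a = 0 := by
    rw [hconst.deriv.deriv_eq]
    simp
  linarith

/-- First- and second-order necessary conditions at a local maximum in the plane. -/
theorem IsLocalMax.gradient_conditions {v : E2 → ℝ} {V : E2 → E2} {A : E2 →L[ℝ] E2} {x : E2}
    (hmax : IsLocalMax v x) (hv : ∀ᶠ y in nhds x, HasGradientAt v (V y) y)
    (hV : HasFDerivAt V A x) : V x = 0 ∧ ∀ w, inner ℝ (A w) w ≤ 0 := by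
  refine ⟨?_, fun w => ?_⟩
  · have h := hmax.hasFDerivAt_eq_zero hv.self_of_nhds.hasFDerivAt
    simpa using h
  · have hline (t : ℝ) : HasDerivAt (fun s : ℝ => x + s • w) w t := by
      simpa using ((hasDerivAt_id t).smul_const w).const_add x
    have htend : Filter.Tendsto (fun s : ℝ => x + s • w) (nhds 0) (nhds x) := by
      simpa using (hline 0).continuousAt.tendsto
    refine IsLocalMax.second_deriv_nonpos (f := fun t : ℝ => v (x + t • w))
      (f' := fun t : ℝ => inner ℝ (V (x + t • w)) w) (a := 0) ?_ ?_ ?_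
    · simpa [IsLocalMax, IsMaxFilter] using htend.eventually hmax
    · filter_upwards [htend.eventually hv] with t ht
      simpa [Function.comp_def] using ht.hasFDerivAt.comp_hasDerivAt t (hline t)
    · have hV' : HasFDerivAt V A (x + (0 : ℝ) • w) := by simpa using hV
      simpa using (hV'.comp_hasDerivAt 0 (hline 0)).inner ℝ (hasDerivAt_const (0 : ℝ) w)

/-- The mean curvature operator as a trace plus the Hessian in the direction orthogonal to
the gradient. -/
theorem div2_normalized {u : E2 → ℝ} {A : E2 →L[ℝ] E2} {x : E2}
    (hA : HasFDerivAt (gradient u) A x) :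
    div2 (fun y => (W u y)⁻¹ • gradient u y) x * W u x ^ 3 =
      (∑ i : Fin 2, inner ℝ (A (EuclideanSpace.single i 1)) (EuclideanSpace.single i 1)) +
        inner ℝ (A !₂[-(gradient u x 1), gradient u x 0])
          !₂[-(gradient u x 1), gradient u x 0] := by
  have hpos : 0 < 1 + ‖gradient u x‖ ^ 2 := by positivity
  have hWpos : 0 < W u x := Real.sqrt_pos.2 hpos
  have hWsq : W u x ^ 2 = 1 + ‖gradient u x‖ ^ 2 := Real.sq_sqrt hpos.le
  have hW : HasFDerivAt (W u) _ x := (hA.norm_sq.const_add 1).sqrt hpos.ne'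
  have hX := ((hasDerivAt_inv hWpos.ne').comp_hasFDerivAt x hW).smul hA
  have hq : (!₂[-(gradient u x 1), gradient u x 0] : E2) =
      -(gradient u x 1) • EuclideanSpace.single 0 1 +
        gradient u x 0 • EuclideanSpace.single 1 1 := by
    ext i; fin_cases i <;> simp
  have hnorm : ‖gradient u x‖ ^ 2 = gradient u x 0 ^ 2 + gradient u x 1 ^ 2 := by
    simp [EuclideanSpace.norm_sq_eq, Fin.sum_univ_two]
  rw [hnorm] at hWsq
  rw [div2, show fderiv ℝ (fun y => (W u y)⁻¹ • gradient u y) x = _ from hX.fderiv, hq]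
  have hfderiv (v : E2) :
      fderiv ℝ u x v = gradient u x 0 * v 0 + gradient u x 1 * v 1 := by
    rw [← InnerProductSpace.toDual_symm_apply (𝕜 := ℝ), PiLp.inner_apply, Fin.sum_univ_two]
    simp [gradient, mul_comm]
  have hs : Real.sqrt (1 + ‖gradient u x‖ ^ 2) = W u x := rfl
  rw [hs]
  simp [Fin.sum_univ_two, PiLp.inner_apply, map_add, map_smul, hfderiv]
  generalize gradient u x 0 = p at *
  generalize gradient u x 1 = q at *
  generalize W u x = w at *
  field_simp
  linear_combination ((A (EuclideanSpace.single 0 1)) 0 + (A (EuclideanSpace.single 1 1)) 1) * hWsq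

theorem W_neg (u : E2 → ℝ) (x : E2) : W (fun y => -u y) x = W u x := by
  simp [W, gradient, fderiv_fun_neg]

theorem div2_normalized_neg (u : E2 → ℝ) (x : E2) :
    div2 (fun y => (W (fun z => -u z) y)⁻¹ • gradient (fun z => -u z) y) x =
      -div2 (fun y => (W u y)⁻¹ • gradient u y) x := by
  have h : (fun y => (W (fun z => -u z) y)⁻¹ • gradient (fun z => -u z) y) =
      fun y => -((W u y)⁻¹ • gradient u y) := by
    ext1 y
    simp [W_neg, gradient, fderiv_fun_neg]
  rw [h]
  simp [div2, fderiv_fun_neg]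

/-- At a local maximum of `u + ε‖·‖²/2`, the gradient of `u` is determined and the mean
curvature of its graph is bounded above. -/
theorem div2_normalized_le_of_isLocalMax {u : E2 → ℝ} {D : Set E2} (hD : IsOpen D)
    (hu : ContDiffOn ℝ 2 u D) {x : E2} (hx : x ∈ D) {ε : ℝ}
    (hmax : IsLocalMax (fun y => u y + ε / 2 * ‖y‖ ^ 2) x) :
    gradient u x = -(ε • x) ∧
      div2 (fun y => (W u y)⁻¹ • gradient u y) x * W u x ^ 3 ≤
        -(ε * (2 + ‖gradient u x‖ ^ 2)) := by
  have hux : ContDiffAt ℝ 2 u x := hu.contDiffAt (hD.mem_nhds hx)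
  have hdiff : DifferentiableAt ℝ (gradient u) x :=
    (InnerProductSpace.toDual ℝ E2).symm.differentiableAt.comp x
      ((hux.fderiv_right (m := 1) (by norm_num)).differentiableAt (by norm_num))
  have hA := hdiff.hasFDerivAt
  have hgrad : ∀ᶠ y in nhds x, HasGradientAt (fun y => u y + ε / 2 * ‖y‖ ^ 2)
      (gradient u y + ε • y) y := by
    filter_upwards [hD.mem_nhds hx] with y hy
    have hy' : HasGradientAt u (gradient u y) y :=
      ((hu.contDiffAt (hD.mem_nhds hy)).differentiableAt (by norm_num)).hasGradientAt
    rw [hasGradientAt_iff_hasFDerivAt] at hy' ⊢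
    refine (hy'.add (((hasFDerivAt_id y).norm_sq).const_mul (ε / 2))).congr_fderiv ?_
    ext w
    simp
    ring
  obtain ⟨hzero, hhess⟩ := hmax.gradient_conditions hgrad
    (hA.add ((hasFDerivAt_id x).const_smul ε))
  refine ⟨eq_neg_of_add_eq_zero_left hzero, ?_⟩
  have hhess' (w : E2) : inner ℝ (fderiv ℝ (gradient u) x w) w ≤ -(ε * ‖w‖ ^ 2) := by
    have := hhess w
    simp [inner_add_left, inner_smul_left] at this
    linarith
  rw [div2_normalized hA, Fin.sum_univ_two]
  have h₀ := hhess' (EuclideanSpace.single 0 1)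
  have h₁ := hhess' (EuclideanSpace.single 1 1)
  have h₂ := hhess' !₂[-(gradient u x 1), gradient u x 0]
  have hnorm : ‖(!₂[-(gradient u x 1), gradient u x 0] : E2)‖ ^ 2 = ‖gradient u x‖ ^ 2 := by
    simp [EuclideanSpace.norm_sq_eq, Fin.sum_univ_two, add_comm]
  rw [hnorm] at h₂
  simp only [PiLp.norm_single, norm_one, one_pow, mul_one] at h₀ h₁
  linarith

/-- Strict maximum principle when the operator is positive at critical points. -/
theorem neg_of_div2_pos_at_critical {u : E2 → ℝ} {D : Set E2} (hD : IsOpen D)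
    (hbdd : Bornology.IsBounded D) (hcont : ContinuousOn u (closure D))
    (hbdry : ∀ x ∈ frontier D, u x = 0) (hu : ContDiffOn ℝ 2 u D)
    (hdiv : ∀ x ∈ D, gradient u x = 0 →
      0 < div2 (fun y => (W u y)⁻¹ • gradient u y) x) :
    ∀ x ∈ D, u x < 0 := by
  intro x hx
  have hno {z : E2} (hz : z ∈ D) (hmax : IsMaxOn u (closure D) z) : False := by
    have hloc : IsLocalMax (fun y => u y + 0 / 2 * ‖y‖ ^ 2) z := by
      simpa using hmax.isLocalMax (Filter.mem_of_superset (hD.mem_nhds hz) subset_closure)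
    obtain ⟨hg, hle⟩ := div2_normalized_le_of_isLocalMax hD hu hz hloc
    have hg0 : gradient u z = 0 := by simpa using hg
    have := hdiv z hz hg0
    have hW : W u z = 1 := by simp [W, hg0]
    rw [hW] at hle
    linarith
  obtain ⟨z, hz, hmax⟩ := hbdd.isCompact_closure.exists_isMaxOn ⟨x, subset_closure hx⟩ hcont
  have hzD : z ∉ D := fun h => hno h hmax
  have hz0 : u z = 0 := hbdry z (by rw [hD.frontier_eq]; exact ⟨hz, hzD⟩)
  by_contra! hge
  exact hno hx fun y hy => ((hmax hy).trans hz0.le).trans hge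

/-- Weak maximum principle for the critical value `λ = -1/2`. -/
theorem nonpos_of_div2_ge {u : E2 → ℝ} {D : Set E2} (hD : IsOpen D)
    (hbdd : Bornology.IsBounded D) (hcont : ContinuousOn u (closure D))
    (hbdry : ∀ x ∈ frontier D, u x = 0) (hu : ContDiffOn ℝ 2 u D)
    (hdiv : ∀ x ∈ D, (W u x)⁻¹ - 1 ≤ div2 (fun y => (W u y)⁻¹ • gradient u y) x) :
    ∀ x ∈ closure D, u x ≤ 0 := by
  intro x hx
  obtain ⟨R, hRpos, hR⟩ := hbdd.closure.exists_pos_norm_le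
  have hbound {ε : ℝ} (hε : 0 < ε) (hεR : ε * R ^ 2 ≤ 2) : u x ≤ ε * (R ^ 2 / 2) := by
    obtain ⟨z, hz, hmax⟩ := hbdd.isCompact_closure.exists_isMaxOn ⟨x, hx⟩
      (f := fun y => u y + ε / 2 * ‖y‖ ^ 2) (by fun_prop)
    have hzR : ‖z‖ ^ 2 ≤ R ^ 2 := by gcongr; exact hR z hz
    have hzD : z ∉ D := by
      intro hzD
      obtain ⟨hg, hle⟩ := div2_normalized_le_of_isLocalMax hD hu hzD
        (hmax.isLocalMax (Filter.mem_of_superset (hD.mem_nhds hzD) subset_closure))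
      have hd := hdiv z hzD
      have hnorm : ‖gradient u z‖ ^ 2 = ε ^ 2 * ‖z‖ ^ 2 := by
        rw [hg, norm_neg, norm_smul, mul_pow, Real.norm_eq_abs, sq_abs]
      have hWsq : W u z ^ 2 = 1 + ‖gradient u z‖ ^ 2 := Real.sq_sqrt (by positivity)
      have hW1 : 1 ≤ W u z := Real.one_le_sqrt.2 (by nlinarith [sq_nonneg ‖gradient u z‖])
      have hs : ‖gradient u z‖ ^ 2 ≤ 2 * ε := by nlinarith
      generalize div2 (fun y => (W u y)⁻¹ • gradient u y) z = d at *
      generalize ‖gradient u z‖ ^ 2 = s at *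
      generalize W u z = w at *
      have h₁ : (w⁻¹ - 1) * w ^ 3 ≤ d * w ^ 3 := by gcongr
      have h₂ : (w⁻¹ - 1) * w ^ 3 = w ^ 2 - w ^ 3 := by field_simp
      have h₃ : w - 1 ≤ ε := by nlinarith
      have h₄ : w ^ 2 * (w - 1) ≤ w ^ 2 * ε := by gcongr
      nlinarith
    have hz0 : u z = 0 := hbdry z (by rw [hD.frontier_eq]; exact ⟨hz, hzD⟩)
    have h := hmax hx
    simp only [Set.mem_ofPred_eq, hz0] at h
    nlinarith [sq_nonneg ‖x‖]
  by_contra! hpos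
  have hR2 : 0 < R ^ 2 := by positivity
  have h := hbound (ε := min (2 / R ^ 2) (u x / R ^ 2)) (by positivity)
    ((le_div_iff₀ hR2).1 (min_le_left _ _))
  have h' := (le_div_iff₀ hR2).1 (min_le_right (2 / R ^ 2) (u x / R ^ 2))
  linarith

/-- One-sidedness with respect to the boundary plane, graph form: a λ-translating graph
with boundary in the plane z = 0 lies on one side of it, the side determined by the
sign of 1 + 2λ. -/
theorem one_sidedness
    (D : Set E2) (hD : D.Nonempty) (hDopen : IsOpen D) (hDconn : IsConnected D)
    (hDbdd : Bornology.IsBounded D)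
    (lam : ℝ) (u : E2 → ℝ)
    (hcont : ContinuousOn u (closure D))
    (hbdry : ∀ x ∈ frontier D, u x = 0)
    (hsol : SatisfiesSolitonEq lam D u) :
    (lam = -1/2 → ∀ x ∈ closure D, u x = 0) ∧
    (lam > -1/2 → ∀ x ∈ D, u x < 0) ∧
    (lam < -1/2 → ∀ x ∈ D, u x > 0) := by
  obtain ⟨hu, heq⟩ := hsol
  have hbdry' : ∀ x ∈ frontier D, -u x = 0 := fun x hx => by simp [hbdry x hx]
  refine ⟨fun hlam x hx => le_antisymm ?_ ?_, fun hlam => ?_, fun hlam x hx => ?_⟩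
  · refine nonpos_of_div2_ge hDopen hDbdd hcont hbdry hu (fun y hy => ?_) x hx
    rw [heq y hy, hlam]
    linarith
  · refine neg_nonpos.1 (nonpos_of_div2_ge (u := fun y => -u y) hDopen hDbdd hcont.neg hbdry'
      hu.neg (fun y hy => ?_) x hx)
    have hW : (W u y)⁻¹ ≤ 1 :=
      inv_le_one_of_one_le₀ (Real.one_le_sqrt.2 (by nlinarith [sq_nonneg ‖gradient u y‖]))
    rw [div2_normalized_neg, W_neg, heq y hy, hlam]
    linarith
  · refine neg_of_div2_pos_at_critical hDopen hDbdd hcont hbdry hu fun y hy hg => ?_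
    rw [heq y hy]
    simp only [W, hg, norm_zero]
    norm_num
    linarith
  · refine neg_neg_iff_pos.1 (neg_of_div2_pos_at_critical (u := fun y => -u y) hDopen hDbdd
      hcont.neg hbdry' hu.neg (fun y hy hg => ?_) x hx)
    have hW : W u y = 1 := by
      rw [← W_neg]
      simp [W, hg]
    rw [div2_normalized_neg, heq y hy, hW]
    linarith
end
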